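/- Let W = ῑ⁻¹(Y), where ῑ is the restriction of the insertion map ι to G₁^c × Ω⁽²⁾. Then ῑ ∘ φ is the identity on Y, the restriction ῑ|_W : W → Y is a Borel isomorphism, and it conjugates the dynamics: ῑ|_W ∘ (T̄|_W) = σ_Y ∘ ῑ|_W. In particular, the systems (W, T̄|_W) and (Y, σ_Y) are Borel isomorphic. -/

import Mathlib

open MeasureTheory Filter Set
open scoped ENNReal Classical

noncomputable section

/-- The sequence space `{0,1}^{ℕ*}`; index `n : ℕ` represents the positive integer `n + 1`. -/
abbrev Omega2 : Type := ℕ → Bool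

/-- The left shift `(σ x)_n = x_{n+1}`. -/
def shift : Omega2 → Omega2 := fun x n => x (n + 1)

/-- `x` omits the residue class `a` modulo `q` (the position of index `n` is `n + 1`). -/
def OmitsMod (x : Omega2) (q : ℕ) (a : ZMod q) : Prop :=
  ∀ n : ℕ, ((n + 1 : ℕ) : ZMod q) = a → x n = false

/-- The squarefree flow: sequences whose support omits at least one residue class
modulo `p ^ 2` for every prime `p`. -/
def SqfFlow : Set Omega2 :=
  {x | ∀ p : Nat.Primes, ∃ a : ZMod ((p : ℕ) ^ 2), OmitsMod x ((p : ℕ) ^ 2) a}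

instance (p : Nat.Primes) : NeZero ((p : ℕ) ^ 2) := ⟨pow_ne_zero 2 p.2.ne_zero⟩
instance (n : ℕ) : MeasurableSpace (ZMod n) := ⊤
instance (n : ℕ) : TopologicalSpace (ZMod n) := ⊥
instance (n : ℕ) : DiscreteTopology (ZMod n) := ⟨rfl⟩

/-- The group `G = ∏_p ℤ/p²ℤ`. -/
abbrev G : Type := ∀ p : Nat.Primes, ZMod ((p : ℕ) ^ 2)

/-- Translation by `(-1, -1, -1, …)` on `G`. -/
def T1 : G → G := fun g p => g p - 1

/-- `G₁ = {g : g_p ≡ 1 mod p² for some prime p}`. -/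
def G1 : Set G := {g | ∃ p : Nat.Primes, g p = 1}

/-- Shannon entropy of the finite partition of `α` induced by `f`. -/
def partH {α β : Type*} [MeasurableSpace α] [Fintype β] (μ : Measure α) (f : α → β) : ℝ :=
  ∑ b : β, Real.negMulLog ((μ (f ⁻¹' {b})).toReal)

/-- Entropy of the process generated by the observable `f` under `T`. -/
def procH {α : Type*} [MeasurableSpace α] (μ : Measure α) (T : α → α)
    {k : ℕ} (f : α → Fin k) : ℝ :=
  ⨅ n : ℕ, partH μ (fun x (i : Fin (n + 1)) => f (T^[(i : ℕ)] x)) / (n + 1)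

/-- Kolmogorov–Sinai entropy of `T` with respect to `μ`: supremum over finite measurable
partitions (encoded as finite-valued measurable observables). -/
def ksEntropy {α : Type*} [MeasurableSpace α] (μ : Measure α) (T : α → α) : EReal :=
  ⨆ (k : ℕ) (f : α → Fin k) (_ : Measurable f), ((procH μ T f : ℝ) : EReal)

/-- First return time (`0` if the point never returns). -/
def retTime {α : Type*} (T : α → α) (Y : Set α) (x : α) : ℕ :=
  sInf {n : ℕ | 0 < n ∧ T^[n] x ∈ Y}

/-- Induced (first–return) transformation, as a map of the ambient space. -/
def inducedAmb {α : Type*} (T : α → α) (Y : Set α) (x : α) : α :=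
  T^[retTime T Y x] x

/-- Number of omitted residue classes modulo `q`. -/
def numOmitted (x : Omega2) (q : ℕ) : ℕ := Set.ncard {a : ZMod q | OmitsMod x q a}

/-- `x` is persistent modulo `q`: every residue class meeting the support meets it infinitely. -/
def Persistent (x : Omega2) (q : ℕ) : Prop :=
  ∀ a : ZMod q, (∃ n : ℕ, ((n + 1 : ℕ) : ZMod q) = a ∧ x n = true) →
    {n : ℕ | ((n + 1 : ℕ) : ZMod q) = a ∧ x n = true}.Infinite

/-- The set of `p`-persistent sequences in the squarefree flow. -/
def SP (p : Nat.Primes) : Set Omega2 := {x ∈ SqfFlow | Persistent x ((p : ℕ) ^ 2)}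

/-- `X_I`: sequences omitting exactly `I p` classes mod `p²` and persistent for every `p`. -/
def XI (I : Nat.Primes → ℕ) : Set Omega2 :=
  {x ∈ SqfFlow | (∀ p : Nat.Primes, numOmitted x ((p : ℕ) ^ 2) = I p) ∧
    ∀ p : Nat.Primes, Persistent x ((p : ℕ) ^ 2)}

/-- `X₁ = X_{(1,1,1,…)}`. -/
def X1 : Set Omega2 := XI fun _ => 1

/-- `ρ(x)_p` is the (unique, for `x ∈ X₁`) omitted residue class mod `p²`. -/
def rho (x : Omega2) : G := fun p =>
  if h : ∃ a : ZMod ((p : ℕ) ^ 2), OmitsMod x ((p : ℕ) ^ 2) a then h.choose else 0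

/-- `Y = ρ⁻¹(G₁ᶜ) ⊆ X₁`. -/
def Y : Set Omega2 := {x ∈ X1 | rho x ∈ G1ᶜ}

/-- `α_g(m) = #{1 ≤ n ≤ m : n ≡ g_p mod p² for some prime p}`. -/
def alphaG (g : G) (m : ℕ) : ℕ :=
  Set.ncard {n : ℕ | 1 ≤ n ∧ n ≤ m ∧ ∃ p : Nat.Primes, ((n : ℕ) : ZMod ((p : ℕ) ^ 2)) = g p}

/-- The insertion map `ι : G × Ω⁽²⁾ → X`; position of index `n` is `m = n + 1`, and the
`1`-based value `y_{m - α_g(m)}` is the `0`-based entry `y (n - α_g(n+1))`. -/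
def iota (g : G) (y : Omega2) : Omega2 := fun n =>
  if ∃ p : Nat.Primes, ((n + 1 : ℕ) : ZMod ((p : ℕ) ^ 2)) = g p then false
  else y (n - alphaG g (n + 1))

/-- The skew product `T(g,y) = (T₁ g, σ^{ψ(g)} y)`, `ψ = 1 - 1_{G₁}`. -/
def skewT : G × Omega2 → G × Omega2 := fun gy =>
  if gy.1 ∈ G1 then (T1 gy.1, gy.2) else (T1 gy.1, shift gy.2)

/-- `G₁ᶜ × Ω⁽²⁾` as a subset of `G × Ω⁽²⁾`. -/
def ZSet : Set (G × Omega2) := G1ᶜ ×ˢ (Set.univ : Set Omega2)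

/-- `x̂`: delete from `x` the entries at positions congruent to `(g_x)_p` mod `p²` for some `p`. -/
def hat (x : Omega2) : Omega2 := fun m =>
  x (Nat.nth (fun j => ¬ ∃ p : Nat.Primes, ((j + 1 : ℕ) : ZMod ((p : ℕ) ^ 2)) = rho x p) m)

/-- A Haar probability measure on `G`: a translation-invariant Borel probability measure. -/
def IsHaarLike (m : Measure G) : Prop :=
  IsProbabilityMeasure m ∧ ∀ g : G, MeasurePreserving (fun h => g + h) m m

/-- The `(1/2, 1/2)` Bernoulli measure on `Ω⁽²⁾`, characterized by its cylinder values. -/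
def IsBernoulliHalf (ω : Measure Omega2) : Prop :=
  IsProbabilityMeasure ω ∧
    ∀ (s : Finset ℕ) (v : ℕ → Bool), ω {x | ∀ i ∈ s, x i = v i} = (1 / 2 : ℝ≥0∞) ^ s.card

/-- Normalized restriction of a measure on `G` to `G₁ᶜ`. -/
def mbar (m : Measure G) : Measure G := (m G1ᶜ)⁻¹ • m.restrict G1ᶜ

/-- The `k`-th prime (`0`-indexed), as an element of `Nat.Primes`. -/
def nthPrime (k : ℕ) : Nat.Primes := ⟨Nat.nth Nat.Prime k, Nat.prime_nth_prime k⟩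

/-- `X(r)`: sequences omitting at least one class mod `p_i²` for the first `r` primes. -/
def Xr (r : ℕ) : Set Omega2 :=
  {x | ∀ k : Fin r, ∃ a : ZMod ((nthPrime k : ℕ) ^ 2), OmitsMod x ((nthPrime k : ℕ) ^ 2) a}

/-- `X_I(r)`: elements of `X(r)` omitting exactly `I k` classes mod `p_k²` for `k ≤ r`. -/
def XIr (r : ℕ) (I : Fin r → ℕ) : Set Omega2 :=
  {x ∈ Xr r | ∀ k : Fin r, numOmitted x ((nthPrime k : ℕ) ^ 2) = I k}

/-- Number of distinct words of length `L` occurring in elements of `F`. -/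
def wordCount (F : Set Omega2) (L : ℕ) : ℕ :=
  Set.ncard {w : Fin L → Bool | ∃ x ∈ F, ∃ j : ℕ, ∀ t : Fin L, w t = x (j + (t : ℕ))}

/-- `α_g^r(m)`, counting only the first `r` primes. -/
def alphaGr (r : ℕ) (g : G) (m : ℕ) : ℕ :=
  Set.ncard {n : ℕ | 1 ≤ n ∧ n ≤ m ∧
    ∃ k : Fin r, ((n : ℕ) : ZMod ((nthPrime k : ℕ) ^ 2)) = g (nthPrime k)}

/-- The partial insertion map `ι_r`. -/
def iotaR (r : ℕ) (g : G) (y : Omega2) : Omega2 := fun n =>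
  if ∃ k : Fin r, ((n + 1 : ℕ) : ZMod ((nthPrime k : ℕ) ^ 2)) = g (nthPrime k) then false
  else y (n - alphaGr r g (n + 1))


/-- `W = ῑ⁻¹(Y)`, where `ῑ` is the restriction of the insertion map to `G₁ᶜ × Ω⁽²⁾`. -/
def W : Set (G × Omega2) := {gy ∈ ZSet | iota gy.1 gy.2 ∈ Y}

/-- The index `j` (position `j + 1`) lies in none of the residue classes `g_p` mod `p²`. -/
def IsFree (g : G) (j : ℕ) : Prop :=
  ¬ ∃ p : Nat.Primes, ((j + 1 : ℕ) : ZMod ((p : ℕ) ^ 2)) = g p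

theorem alphaG_eq_count (g : G) (n : ℕ) : alphaG g n = Nat.count (fun j => ¬ IsFree g j) n := by
  rw [Nat.count_eq_card_filter_range, alphaG, ← Set.ncard_coe_finset,
    ← Set.ncard_image_of_injective (Finset.filter (fun j => ¬ IsFree g j) (Finset.range n) : Set ℕ)
      Nat.succ_injective]
  congr 1
  ext m
  simp only [IsFree, not_not, Set.mem_ofPred_eq, Finset.coe_filter, Finset.mem_range,
    Set.mem_image]
  constructor
  · rintro ⟨h1, h2, h3⟩
    obtain ⟨k, rfl⟩ := Nat.exists_eq_add_of_le' h1
    exact ⟨k, ⟨h2, h3⟩, rfl⟩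
  · rintro ⟨k, ⟨hk, h3⟩, rfl⟩
    exact ⟨Nat.succ_pos k, hk, h3⟩

theorem count_add_count_not (P : ℕ → Prop) (n : ℕ) :
    Nat.count P n + Nat.count (fun j => ¬ P j) n = n := by
  induction n with
  | zero => simp
  | succ n ih =>
    by_cases h : P n
    · simp only [Nat.count_succ, h, not_true_eq_false, if_true, if_false]; omega
    · simp only [Nat.count_succ, h, not_false_eq_true, if_true, if_false]; omega

theorem iota_apply (g : G) (y : Omega2) (n : ℕ) :
    iota g y n = if IsFree g n then y (Nat.count (IsFree g) n) else false := by
  by_cases h : IsFree g n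
  · have h1 := count_add_count_not (IsFree g) n
    have h2 : n - alphaG g (n + 1) = Nat.count (IsFree g) n := by
      rw [alphaG_eq_count, Nat.count_succ, if_neg (not_not.mpr h)]
      omega
    rw [if_pos h, iota, if_neg h, h2]
  · rw [if_neg h, iota, if_pos (not_not.mp h)]

theorem omitsMod_iota (g : G) (y : Omega2) (p : Nat.Primes) :
    OmitsMod (iota g y) ((p : ℕ) ^ 2) (g p) := fun n hn => by
  rw [iota_apply, if_neg (fun h => h ⟨p, hn⟩)]

theorem omitsMod_iff_of_mem_X1 {x : Omega2} (hx : x ∈ X1) (p : Nat.Primes)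
    (a : ZMod ((p : ℕ) ^ 2)) : OmitsMod x ((p : ℕ) ^ 2) a ↔ rho x p = a := by
  have hr : OmitsMod x ((p : ℕ) ^ 2) (rho x p) := by
    rw [rho, dif_pos (hx.1 p)]
    exact (hx.1 p).choose_spec
  constructor
  · intro ha
    obtain ⟨b, hb⟩ := Set.ncard_eq_one.mp (hx.2.1 p)
    have h1 : a ∈ ({b} : Set (ZMod ((p : ℕ) ^ 2))) := hb ▸ ha
    have h2 : rho x p ∈ ({b} : Set (ZMod ((p : ℕ) ^ 2))) := hb ▸ hr
    exact h2.trans h1.symm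
  · rintro rfl
    exact hr

theorem rho_iota {g : G} {y : Omega2} (h : iota g y ∈ X1) : rho (iota g y) = g :=
  funext fun p => (omitsMod_iff_of_mem_X1 h p _).mp (omitsMod_iota g y p)

theorem eq_false_of_not_isFree {x : Omega2} (hx : x ∈ X1) {n : ℕ} (hn : ¬ IsFree (rho x) n) :
    x n = false := by
  obtain ⟨p, hp⟩ := not_not.mp hn
  exact (omitsMod_iff_of_mem_X1 hx p _).mpr rfl n hp

theorem infinite_isFree {x : Omega2} (hx : x ∈ X1) : {n | IsFree (rho x) n}.Infinite := by
  let p : Nat.Primes := ⟨2, Nat.prime_two⟩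
  have hne : rho x p + 1 ≠ rho x p := by
    have : Fact (1 < (p : ℕ) ^ 2) := ⟨by norm_num [p]⟩
    simp
  have hnot : ¬ OmitsMod x ((p : ℕ) ^ 2) (rho x p + 1) := fun h =>
    hne ((omitsMod_iff_of_mem_X1 hx p _).mp h).symm
  have hex : ∃ n : ℕ, ((n + 1 : ℕ) : ZMod ((p : ℕ) ^ 2)) = rho x p + 1 ∧ x n = true := by
    simpa only [OmitsMod, not_forall, exists_prop, Bool.not_eq_false] using hnot
  refine (hx.2.2 p _ hex).mono fun n hn => ?_
  by_contra h
  exact Bool.false_ne_true ((eq_false_of_not_isFree hx h).symm.trans hn.2)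

theorem iota_rho_hat {x : Omega2} (hx : x ∈ X1) : iota (rho x) (hat x) = x := by
  funext n
  rw [iota_apply]
  split_ifs with h
  · change x (Nat.nth (IsFree (rho x)) _) = x n
    rw [Nat.nth_count h]
  · exact (eq_false_of_not_isFree hx h).symm

theorem hat_iota {g : G} {y : Omega2} (h : iota g y ∈ X1) : hat (iota g y) = y := by
  have hinf := infinite_isFree h
  funext m
  change iota g y (Nat.nth (IsFree (rho (iota g y))) m) = y m
  rw [rho_iota h] at hinf ⊢
  rw [iota_apply, if_pos (Nat.nth_mem_of_infinite hinf m), Nat.count_nth_of_infinite hinf]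

theorem omitsMod_shift {x : Omega2} {q : ℕ} (hx : Persistent x q) (a : ZMod q) :
    OmitsMod (shift x) q a ↔ OmitsMod x q (a + 1) := by
  constructor
  · intro h
    have hpos : ∀ n : ℕ, ((n + 1 : ℕ) : ZMod q) = a + 1 → x n = true → n = 0 := by
      intro n hn hxn
      by_contra h0
      obtain ⟨k, rfl⟩ := Nat.exists_eq_succ_of_ne_zero h0
      have := h k (add_right_cancel (b := 1) (by rwa [← Nat.cast_add_one]))
      exact Bool.false_ne_true (this.symm.trans hxn)
    intro n hn
    by_contra hxn
    refine hx (a + 1) ⟨n, hn, by simpa using hxn⟩ ((Set.finite_singleton 0).subset ?_)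
    exact fun m hm => hpos m hm.1 hm.2
  · intro h n hn
    exact h (n + 1) (by rw [Nat.cast_add_one, hn])

theorem Persistent.shift {x : Omega2} {q : ℕ} (hx : Persistent x q) :
    Persistent (shift x) q := by
  rintro a ⟨n, hn, hxn⟩ hfin
  refine hx (a + 1) ⟨n + 1, by rw [Nat.cast_add_one, hn], hxn⟩ ?_
  refine ((hfin.image Nat.succ).insert 0).subset ?_
  rintro (_ | m) ⟨hm, hxm⟩
  · exact Or.inl rfl
  · exact Or.inr ⟨m, ⟨add_right_cancel (b := 1) (by rwa [← Nat.cast_add_one]), hxm⟩, rfl⟩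

theorem shift_mem_X1 {x : Omega2} (hx : x ∈ X1) : shift x ∈ X1 := by
  have key : ∀ (p : Nat.Primes) (a : ZMod ((p : ℕ) ^ 2)),
      OmitsMod (shift x) ((p : ℕ) ^ 2) a ↔ a = rho x p - 1 := fun p a => by
    rw [omitsMod_shift (hx.2.2 p), omitsMod_iff_of_mem_X1 hx, eq_sub_iff_add_eq, eq_comm]
  refine ⟨fun p => ⟨_, (key p _).mpr rfl⟩, fun p => ?_, fun p => (hx.2.2 p).shift⟩
  simp only [numOmitted, key, Set.ofPred_eq_eq_singleton, Set.ncard_singleton]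

theorem rho_shift {x : Omega2} (hx : x ∈ X1) : rho (shift x) = T1 (rho x) := by
  funext p
  rw [← omitsMod_iff_of_mem_X1 (shift_mem_X1 hx), omitsMod_shift (hx.2.2 p),
    omitsMod_iff_of_mem_X1 hx, T1, sub_add_cancel]

theorem isFree_T1 (g : G) (j : ℕ) : IsFree (T1 g) j ↔ IsFree g (j + 1) := by
  refine not_congr (exists_congr fun p => ?_)
  rw [T1, eq_sub_iff_add_eq, Nat.cast_add_one (j + 1)]

theorem isFree_zero (g : G) : IsFree g 0 ↔ g ∉ G1 := by
  simp [IsFree, G1, eq_comm]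

theorem iota_skewT (gy : G × Omega2) :
    iota (skewT gy).1 (skewT gy).2 = shift (iota gy.1 gy.2) := by
  obtain ⟨g, y⟩ := gy
  have hfree : IsFree (T1 g) = fun j => IsFree g (j + 1) :=
    funext fun j => propext (isFree_T1 g j)
  funext n
  by_cases h : g ∈ G1
  · have h0 : ¬ IsFree g 0 := fun h' => (isFree_zero g).mp h' h
    simp only [skewT, if_pos h, shift, iota_apply, Nat.count_succ', if_neg h0, hfree, add_zero]
  · have h0 : IsFree g 0 := (isFree_zero g).mpr h
    simp only [skewT, if_neg h, shift, iota_apply, Nat.count_succ', if_pos h0, hfree]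

theorem skewT_fst (gy : G × Omega2) : (skewT gy).1 = T1 gy.1 := by
  rw [skewT]
  split_ifs <;> rfl

theorem iota_skewT_iterate (n : ℕ) (gy : G × Omega2) :
    iota (skewT^[n] gy).1 (skewT^[n] gy).2 = shift^[n] (iota gy.1 gy.2) := by
  induction n with
  | zero => rfl
  | succ n ih => rw [Function.iterate_succ_apply', Function.iterate_succ_apply', iota_skewT, ih]

theorem shift_iterate_mem_X1 {x : Omega2} (hx : x ∈ X1) (n : ℕ) : shift^[n] x ∈ X1 := by
  induction n with
  | zero => exact hx
  | succ n ih =>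
    rw [Function.iterate_succ_apply']
    exact shift_mem_X1 ih

theorem isFree_skewT_iterate (n j : ℕ) (gy : G × Omega2) :
    IsFree (skewT^[n] gy).1 j ↔ IsFree gy.1 (j + n) := by
  induction n generalizing j with
  | zero => rfl
  | succ n ih =>
    rw [Function.iterate_succ_apply', skewT_fst, isFree_T1, ih, Nat.add_right_comm, Nat.add_assoc]

theorem skewT_iterate_mem_ZSet (n : ℕ) (gy : G × Omega2) :
    skewT^[n] gy ∈ ZSet ↔ IsFree gy.1 n := by
  rw [← Nat.zero_add n, ← isFree_skewT_iterate, isFree_zero, Nat.zero_add]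
  simp [ZSet]

theorem mem_Y_iff {g : G} {y : Omega2} (h : iota g y ∈ X1) :
    iota g y ∈ Y ↔ (g, y) ∈ ZSet := by
  simp [Y, ZSet, h, rho_iota h]

theorem shift_iterate_mem_Y {gy : G × Omega2} (h : iota gy.1 gy.2 ∈ X1) (n : ℕ) :
    shift^[n] (iota gy.1 gy.2) ∈ Y ↔ skewT^[n] gy ∈ ZSet := by
  have := shift_iterate_mem_X1 h n
  rw [← iota_skewT_iterate] at this ⊢
  exact mem_Y_iff this

theorem retTime_shift_iota {gy : G × Omega2} (h : iota gy.1 gy.2 ∈ X1) :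
    retTime shift Y (iota gy.1 gy.2) = retTime skewT ZSet gy := by
  simp only [retTime, shift_iterate_mem_Y h]

theorem iota_inducedAmb {gy : G × Omega2} (h : iota gy.1 gy.2 ∈ X1) :
    iota (inducedAmb skewT ZSet gy).1 (inducedAmb skewT ZSet gy).2 =
      inducedAmb shift Y (iota gy.1 gy.2) := by
  rw [inducedAmb, inducedAmb, retTime_shift_iota h, iota_skewT_iterate]

theorem inducedAmb_mem_W {gy : G × Omega2} (h : iota gy.1 gy.2 ∈ X1) :
    inducedAmb skewT ZSet gy ∈ W := by
  have hinf := infinite_isFree h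
  rw [rho_iota h] at hinf
  obtain ⟨n, hn, hn0⟩ := hinf.exists_gt 0
  have hne : {n : ℕ | 0 < n ∧ skewT^[n] gy ∈ ZSet}.Nonempty :=
    ⟨n, hn0, (skewT_iterate_mem_ZSet n gy).mpr hn⟩
  have hmem : inducedAmb skewT ZSet gy ∈ ZSet := (Nat.sInf_mem hne).2
  refine ⟨hmem, ?_⟩
  rw [iota_inducedAmb h, inducedAmb, retTime_shift_iota h, shift_iterate_mem_Y h]
  exact hmem

theorem measurableSet_isFree (n : ℕ) : MeasurableSet {g : G | IsFree g n} := by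
  have h : {g : G | IsFree g n} =
      ⋂ p : Nat.Primes, (fun g : G => g p) ⁻¹' {((n + 1 : ℕ) : ZMod ((p : ℕ) ^ 2))}ᶜ := by
    ext g
    simp [IsFree, eq_comm]
  rw [h]
  exact MeasurableSet.iInter fun p => measurable_pi_apply p MeasurableSpace.measurableSet_top

theorem measurable_count_isFree (n : ℕ) :
    Measurable fun g : G => Nat.count (IsFree g) n := by
  induction n with
  | zero => simp only [Nat.count_zero, measurable_const]
  | succ n ih =>
    simp only [Nat.count_succ]
    exact ih.add (Measurable.ite (measurableSet_isFree n) measurable_const measurable_const)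

theorem measurable_eval {α : Type*} [MeasurableSpace α] {f : α → Omega2} {k : α → ℕ}
    (hf : Measurable f) (hk : Measurable k) : Measurable fun a => f a (k a) := by
  have h : Measurable fun z : Omega2 × ℕ => z.1 z.2 :=
    measurable_from_prod_countable_left fun n => measurable_pi_apply n
  exact h.comp (hf.prodMk hk)

theorem measurable_iota : Measurable fun gy : G × Omega2 => iota gy.1 gy.2 := by
  refine measurable_pi_lambda _ fun n => ?_
  simp only [iota_apply]
  exact Measurable.ite (measurable_fst (measurableSet_isFree n))
    (measurable_eval measurable_snd ((measurable_count_isFree n).comp measurable_fst))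
    measurable_const

theorem measurableSet_omitsMod (q : ℕ) (a : ZMod q) :
    MeasurableSet {x : Omega2 | OmitsMod x q a} := by
  simp only [OmitsMod, Set.ofPred_forall]
  exact MeasurableSet.iInter fun n => MeasurableSet.iInter fun _ =>
    measurableSet_eq_fun (measurable_pi_apply n) measurable_const

theorem measurable_rho : Measurable fun x : Y => rho (x : Omega2) := by
  refine measurable_pi_lambda _ fun p => measurable_to_countable' fun a => ?_
  have h : (fun x : Y => rho (x : Omega2) p) ⁻¹' {a} =
      Subtype.val ⁻¹' {x : Omega2 | OmitsMod x ((p : ℕ) ^ 2) a} := by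
    ext x
    exact (omitsMod_iff_of_mem_X1 x.2.1 p a).symm
  rw [h]
  exact measurable_subtype_coe (measurableSet_omitsMod _ a)

theorem nth_eq_iff {P : ℕ → Prop} (hP : (Set.ofPred P).Infinite) (m k : ℕ) :
    Nat.nth P m = k ↔ P k ∧ Nat.count P k = m := by
  constructor
  · rintro rfl
    exact ⟨Nat.nth_mem_of_infinite hP m, Nat.count_nth_of_infinite hP m⟩
  · rintro ⟨hk, rfl⟩
    exact Nat.nth_count hk

theorem measurable_hat : Measurable fun x : Y => hat (x : Omega2) := by
  refine measurable_pi_lambda _ fun m => measurable_eval (f := Subtype.val)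
    measurable_subtype_coe (measurable_to_countable' fun k => ?_)
  have h : (fun x : Y => Nat.nth (IsFree (rho (x : Omega2))) m) ⁻¹' {k} =
      (fun x : Y => rho (x : Omega2)) ⁻¹'
        ({g | IsFree g k} ∩ (fun g : G => Nat.count (IsFree g) k) ⁻¹' {m}) := by
    ext x
    exact nth_eq_iff (infinite_isFree x.2.1) m k
  exact h ▸ measurable_rho ((measurableSet_isFree k).inter
    (measurable_count_isFree k (measurableSet_singleton m)))

/-- `ῑ ∘ φ = id` on `Y`; the restriction `ῑ|_W : W → Y` is a Borel
isomorphism (a bijection, with inverse `φ`, measurable in both directions) conjugating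
`T̄|_W` with `σ_Y`; in particular the systems `(W, T̄|_W)` and `(Y, σ_Y)` are Borel
isomorphic. -/
theorem insertion_borel_isomorphism :
    (∀ x ∈ Y, iota (rho x) (hat x) = x) ∧
    Set.BijOn (fun gy : G × Omega2 => iota gy.1 gy.2) W Y ∧
    Set.InvOn (fun x : Omega2 => ((rho x, hat x) : G × Omega2))
      (fun gy : G × Omega2 => iota gy.1 gy.2) W Y ∧
    Measurable (fun gy : ↥W => iota (gy : G × Omega2).1 (gy : G × Omega2).2) ∧
    Measurable (fun x : ↥Y => ((rho (x : Omega2), hat (x : Omega2)) : G × Omega2)) ∧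
    Set.MapsTo (inducedAmb skewT ZSet) W W ∧
    ∀ gy ∈ W, iota (inducedAmb skewT ZSet gy).1 (inducedAmb skewT ZSet gy).2 =
      inducedAmb shift Y (iota gy.1 gy.2) := by
  have hleft : ∀ gy ∈ W, (rho (iota gy.1 gy.2), hat (iota gy.1 gy.2)) = gy := fun gy hgy =>
    Prod.ext (rho_iota hgy.2.1) (hat_iota hgy.2.1)
  have hright : ∀ x ∈ Y, iota (rho x) (hat x) = x := fun x hx => iota_rho_hat hx.1
  have hinv : Set.InvOn (fun x : Omega2 => ((rho x, hat x) : G × Omega2))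
      (fun gy : G × Omega2 => iota gy.1 gy.2) W Y := ⟨hleft, hright⟩
  refine ⟨hright, hinv.bijOn (fun gy hgy => hgy.2) fun x hx => ?_, hinv,
    measurable_iota.comp measurable_subtype_coe, measurable_rho.prodMk measurable_hat,
    fun gy hgy => inducedAmb_mem_W hgy.2.1, fun gy hgy => iota_inducedAmb hgy.2.1⟩
  refine ⟨⟨hx.2, Set.mem_univ _⟩, ?_⟩
  rw [hright x hx]
  exact hx

end
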